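/- Gronwall inequality with singular forcing: Let α ∈ (0,1), ȳ ≥ 0 a constant, ȳ(·) : (0,1] → ℝ a nonnegative continuous function with ϑ ↦ ϑ^(1−α) ȳ(ϑ) bounded, and c ≥ 0. If y : (0,1] → ℝ is continuous with ϑ ↦ ϑ^(1−α) y(ϑ) bounded and satisfies y(ϑ) ≤ ȳ/(Γ(α)ϑ^(1−α)) + ȳ(ϑ) + (c/Γ(α)) ∫₀^ϑ y(ζ)(ϑ−ζ)^(α−1) dζ for all ϑ ∈ (0,1], then y(ϑ) ≤ E_{α,α}(c) ȳ / ϑ^(1−α) + ȳ(ϑ) + c E_{α,α}(c) ∫₀^ϑ ȳ(ζ)(ϑ−ζ)^(α−1) dζ for all ϑ ∈ (0,1]. -/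

import Mathlib

open MeasureTheory Real Set Filter

noncomputable def mittagLeffler (α z : ℝ) : ℝ := ∑' k : ℕ, z ^ k / Real.Gamma (α * (k + 1))

open scoped ENNReal

noncomputable def kk (a u : ℝ) : ℝ≥0∞ :=
  if 0 < u then ENNReal.ofReal (u ^ (a - 1) / Real.Gamma a) else 0

lemma kk_meas (a : ℝ) : Measurable (kk a) := by
  unfold kk
  exact Measurable.ite measurableSet_Ioi (by fun_prop) (by fun_prop)

lemma lintegral_scale (f : ℝ → ℝ≥0∞) (x : ℝ) (hx : 0 < x) :
    ∫⁻ y, f y = ENNReal.ofReal x * ∫⁻ u, f (x * u) := by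
  have h := Real.smul_map_volume_mul_left (a := x) hx.ne'
  have he : MeasurableEmbedding (fun u : ℝ => x * u) :=
    (Homeomorph.mulLeft₀ x hx.ne').measurableEmbedding
  conv_lhs => rw [← h]
  rw [lintegral_smul_measure, he.lintegral_map, abs_of_pos hx]
  rfl

lemma kk_conv {a b : ℝ} (ha : 0 < a) (hb : 0 < b) :
    lconvolution (kk a) (kk b) volume = kk (a + b) := by
  ext x
  rw [lconvolution_def]
  by_cases hx : 0 < x
  · rw [lintegral_scale _ x hx]
    have hp : ∀ u, ENNReal.ofReal x * (kk a (x * u) * kk b (-(x * u) + x))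
        = kk (a + b) x * ProbabilityTheory.betaPDF a b u := by
      intro u
      rcases le_or_gt u 0 with hu | hu
      · rw [ProbabilityTheory.betaPDF_eq_zero_of_nonpos hu]
        have : ¬ 0 < x * u := by nlinarith
        simp [kk, this]
      rcases le_or_gt 1 u with hu1 | hu1
      · rw [ProbabilityTheory.betaPDF_eq_zero_of_one_le hu1]
        have : ¬ 0 < -(x * u) + x := by nlinarith
        simp only [kk, this]
        simp
      rw [ProbabilityTheory.betaPDF_of_pos_lt_one hu hu1]
      have h1 : 0 < x * u := by positivity
      have h2 : 0 < 1 - u := by linarith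
      have h3 : -(x * u) + x = x * (1 - u) := by ring
      have h4 : 0 < x * (1 - u) := by positivity
      have ga := Real.Gamma_pos_of_pos ha
      have gb := Real.Gamma_pos_of_pos hb
      have gab := Real.Gamma_pos_of_pos (add_pos ha hb)
      simp only [kk, h3, h1, h4, hx, if_true]
      rw [← ENNReal.ofReal_mul (by positivity), ← ENNReal.ofReal_mul (by positivity),
        ← ENNReal.ofReal_mul (by positivity)]
      congr 1
      rw [Real.mul_rpow hx.le hu.le, Real.mul_rpow hx.le h2.le, ProbabilityTheory.beta,
        show a + b - 1 = 1 + (a - 1) + (b - 1) by ring, Real.rpow_add hx, Real.rpow_add hx,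
        Real.rpow_one]
      field_simp
    rw [← lintegral_const_mul' _ _ ENNReal.ofReal_ne_top]
    simp_rw [hp]
    rw [lintegral_const_mul' _ _ (by unfold kk; split_ifs <;> simp),
      ProbabilityTheory.lintegral_betaPDF_eq_one ha hb, mul_one]
  · have : ∀ y, kk a y * kk b (-y + x) = 0 := by
      intro y
      by_cases hy : 0 < y
      · have : ¬ 0 < -y + x := by linarith
        simp only [kk, this]; simp
      · simp [kk, hy]
    simp only [this]
    simp [kk, hx]

lemma iter {α : ℝ} (hα : 0 < α) (F Y : ℝ → ℝ≥0∞) (hF : Measurable F) (g c C : ℝ≥0∞)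
    (hY : ∀ x, Y x ≤ C * kk α x)
    (h : ∀ x, Y x ≤ g * kk α x + F x + c * lconvolution Y (kk α) volume x) (n : ℕ) :
    ∀ x, Y x ≤ g * (∑ k ∈ Finset.range n, c ^ k * kk (α * (k + 1)) x) + F x +
      (∑ k ∈ Finset.range n, c ^ (k + 1) * lconvolution F (kk (α * (k + 1))) volume x) +
      C * c ^ n * kk (α * (n + 1)) x := by
  induction n with
  | zero =>
    intro x
    simpa using (hY x).trans le_add_self
  | succ n ih =>
    intro x
    have hk := fun a => kk_meas a
    have hk2 : ∀ k : ℕ, lconvolution (kk (α * (k + 1))) (kk α) volume = kk (α * ((k + 1 : ℕ) + 1)) := by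
      intro k
      rw [kk_conv (by positivity) hα]
      congr 1; push_cast; ring
    have hk3 : ∀ k : ℕ, lconvolution (lconvolution F (kk (α * (k + 1))) volume) (kk α) volume
        = lconvolution F (kk (α * ((k + 1 : ℕ) + 1))) volume := by
      intro k
      rw [← lconvolution_assoc hF (hk _) (hk _), hk2]
    have hk4 : ∀ k : ℕ, Measurable (lconvolution F (kk (α * (k + 1))) volume) :=
      fun k => measurable_lconvolution _ hF (hk _)
    have key : lconvolution Y (kk α) volume x ≤
        g * (∑ k ∈ Finset.range n, c ^ k * kk (α * ((k + 1 : ℕ) + 1)) x) +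
        lconvolution F (kk α) volume x +
      (∑ k ∈ Finset.range n, c ^ (k + 1) * lconvolution F (kk (α * ((k + 1 : ℕ) + 1))) volume x) +
      C * c ^ n * kk (α * ((n + 1 : ℕ) + 1)) x := by
      simp_rw [← hk3, ← hk2]
      simp only [lconvolution_def (g := kk α)]
      have hm : Measurable fun y : ℝ => kk α (-y + x) := (hk α).comp (by fun_prop)
      calc _ ≤ ∫⁻ y, (g * (∑ k ∈ Finset.range n, c ^ k * kk (α * (k + 1)) y) + F y +
      (∑ k ∈ Finset.range n, c ^ (k + 1) * lconvolution F (kk (α * (k + 1))) volume y) +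
      C * c ^ n * kk (α * (n + 1)) y) * kk α (-y + x) := by
            apply lintegral_mono
            intro y
            exact mul_le_mul_left (ih y) _
        _ = _ := by
            simp_rw [add_mul, mul_assoc, Finset.sum_mul, mul_assoc]
            rw [lintegral_add_left, lintegral_add_left, lintegral_add_left,
              lintegral_const_mul, lintegral_finsetSum, lintegral_finsetSum,
              lintegral_const_mul, lintegral_const_mul]
            · congr 2
              · congr 2
                · congr 2
                  ext k
                  rw [lintegral_const_mul]
                  exact (hk _).mul hm
              · refine Finset.sum_congr rfl fun k _ => ?_
                rw [lintegral_const_mul]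
                exact (hk4 _).mul hm
            all_goals fun_prop
    refine (h x).trans ?_
    refine (add_le_add le_rfl (mul_le_mul_right key c)).trans (le_of_eq ?_)
    rw [Finset.sum_range_succ', Finset.sum_range_succ']
    have e1 : ∑ k ∈ Finset.range n, c ^ (k + 1) * kk (α * ((k + 1 : ℕ) + 1)) x =
        c * ∑ k ∈ Finset.range n, c ^ k * kk (α * ((k + 1 : ℕ) + 1)) x := by
      rw [Finset.mul_sum]
      exact Finset.sum_congr rfl fun k _ => by ring
    have e2 : ∑ k ∈ Finset.range n, c ^ (k + 1 + 1) *
          lconvolution F (kk (α * ((k + 1 : ℕ) + 1))) volume x =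
        c * ∑ k ∈ Finset.range n, c ^ (k + 1) *
          lconvolution F (kk (α * ((k + 1 : ℕ) + 1))) volume x := by
      rw [Finset.mul_sum]
      exact Finset.sum_congr rfl fun k _ => by ring
    rw [e1, e2]
    have e0 : α * (((0 : ℕ) : ℝ) + 1) = α := by simp
    rw [e0]
    generalize (∑ k ∈ Finset.range n, c ^ k * kk (α * ((k + 1 : ℕ) + 1)) x) = S1
    generalize (∑ k ∈ Finset.range n, c ^ (k + 1) *
          lconvolution F (kk (α * ((k + 1 : ℕ) + 1))) volume x) = S2
    ring

lemma ofReal_int_le {μ : Measure ℝ} (f : ℝ → ℝ) :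
    ENNReal.ofReal (∫ x, f x ∂μ) ≤ ∫⁻ x, ENNReal.ofReal (f x) ∂μ := by
  by_cases hf : Integrable f μ
  · rw [integral_eq_lintegral_pos_part_sub_lintegral_neg_part hf]
    refine (ENNReal.ofReal_le_ofReal (sub_le_self _ ENNReal.toReal_nonneg)).trans ?_
    exact ENNReal.ofReal_toReal_le
  · simp [integral_undef hf]

lemma gamma_lower {x R : ℝ} (hx : 1 ≤ x) (hR : 0 < R) :
    R ^ (x - 1) * Real.exp (-R) ≤ Real.Gamma x := by
  have h0 : 0 < x := by linarith
  rw [Real.Gamma_eq_integral h0]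
  have hint := Real.GammaIntegral_convergent h0
  have hsub : Ioi R ⊆ Ioi (0:ℝ) := Ioi_subset_Ioi hR.le
  calc R ^ (x - 1) * Real.exp (-R) = ∫ u in Ioi R, R ^ (x - 1) * Real.exp (-u) := by
        rw [integral_const_mul, integral_exp_neg_Ioi]
    _ ≤ ∫ u in Ioi R, Real.exp (-u) * u ^ (x - 1) := by
        apply setIntegral_mono_on
        · exact (integrableOn_exp_neg_Ioi R).const_mul _
        · exact hint.mono_set hsub
        · exact measurableSet_Ioi
        · intro u hu
          rw [mul_comm]
          gcongr
          exact le_of_lt hu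
    _ ≤ _ := by
        apply setIntegral_mono_set hint
        · filter_upwards [ae_restrict_mem measurableSet_Ioi] with u hu
          have : (0:ℝ) < u := hu
          simp only [Pi.zero_apply]; positivity
        · exact hsub.eventuallyLE

lemma ml_summable {α c : ℝ} (hα : 0 < α) (hc : 0 ≤ c) :
    Summable fun k : ℕ => c ^ k / Real.Gamma (α * (k + 1)) := by
  set R : ℝ := (2 * (c + 1)) ^ (1 / α) with hRdef
  have hR : 0 < R := by positivity
  have hRα : R ^ α = 2 * (c + 1) := by
    rw [hRdef, ← Real.rpow_mul (by positivity)]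
    rw [one_div_mul_cancel hα.ne', Real.rpow_one]
  have hgeo : Summable fun k : ℕ => (Real.exp R * R ^ (1 - α)) * (1 / 2 : ℝ) ^ k :=
    (summable_geometric_of_lt_one (by norm_num) (by norm_num)).mul_left _
  refine summable_of_isBigO_nat hgeo (Asymptotics.IsBigO.of_bound 1 ?_)
  obtain ⟨N, hN⟩ := exists_nat_ge (1 / α)
  filter_upwards [eventually_ge_atTop N] with k hk
  have hk' : 1 ≤ α * (k + 1) := by
    have : (N : ℝ) ≤ k := by exact_mod_cast hk
    have h2 : 1 / α ≤ k + 1 := by linarith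
    rw [div_le_iff₀ hα] at h2
    linarith
  have hG := gamma_lower hk' hR
  have hGp : 0 < Real.Gamma (α * (k + 1)) := Real.Gamma_pos_of_pos (by positivity)
  rw [Real.norm_of_nonneg (by positivity), Real.norm_of_nonneg (by positivity), one_mul,
    div_le_iff₀ hGp]
  refine le_trans ?_ (mul_le_mul_of_nonneg_left hG (by positivity))
  have e : R ^ (α * (k + 1) - 1) = R ^ (α - 1) * (2 * (c + 1)) ^ k := by
    rw [← hRα, ← Real.rpow_natCast, ← Real.rpow_mul hR.le, ← Real.rpow_add hR]
    congr 1; ring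
  have e2 : R ^ (1 - α) * R ^ (α - 1) = 1 := by
    rw [← Real.rpow_add hR]; simp
  have e3 : Real.exp R * Real.exp (-R) = 1 := by
    rw [← Real.exp_add]; simp
  rw [e]
  calc c ^ k ≤ (c + 1) ^ k := by gcongr; linarith
    _ = (Real.exp R * Real.exp (-R)) * (R ^ (1 - α) * R ^ (α - 1)) *
      ((1 / 2 : ℝ) ^ k * (2 * (c + 1)) ^ k) := by
        rw [e2, e3, ← mul_pow]; ring_nf
    _ = _ := by ring

lemma conv_eq {α t : ℝ} (hα : α ∈ Ioo (0:ℝ) 1) (ht : t ∈ Ioc (0:ℝ) 1) (h : ℝ → ℝ) :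
    lconvolution ((Ioc (0:ℝ) 1).indicator fun s => ENNReal.ofReal (h s)) (kk α) volume t
      = ENNReal.ofReal (1 / Real.Gamma α) *
        ∫⁻ s in Ioc 0 t, ENNReal.ofReal (h s * (t - s) ^ (α - 1)) := by
  have ga := Real.Gamma_pos_of_pos hα.1
  rw [lconvolution_def, ← lintegral_indicator measurableSet_Ioc,
    ← lintegral_const_mul' _ _ ENNReal.ofReal_ne_top]
  congr 1
  ext s
  by_cases hs : s ∈ Ioc 0 t
  · have hs1 : s ∈ Ioc (0:ℝ) 1 := ⟨hs.1, hs.2.trans ht.2⟩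
    rw [indicator_of_mem hs, indicator_of_mem hs1]
    rcases hs.2.lt_or_eq with h1 | h1
    · have h2 : 0 < -s + t := by linarith
      have h3 : 0 < t - s := by linarith
      rw [kk, if_pos h2, show -s + t = t - s by ring, mul_comm (h s),
        ENNReal.ofReal_mul (Real.rpow_nonneg h3.le _), ← mul_assoc,
        ← ENNReal.ofReal_mul (one_div_nonneg.2 ga.le), mul_comm]
      congr 2
      ring
    · subst h1
      have : α - 1 ≠ 0 := by linarith [hα.2]
      simp [kk, Real.zero_rpow this]
  · rw [indicator_of_notMem hs, mul_zero]
    by_cases h0 : 0 < s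
    · have : ¬ 0 < -s + t := by
        intro h'
        exact hs ⟨h0, by linarith⟩
      simp only [kk, this]; simp
    · rw [indicator_of_notMem (fun h' => h0 h'.1), zero_mul]

lemma kk_bound {α : ℝ} (hα : α ∈ Ioo (0:ℝ) 1) (h : ℝ → ℝ)
    (hb : ∃ K, ∀ ζ ∈ Ioc (0:ℝ) 1, |ζ ^ (1 - α) * h ζ| ≤ K) :
    ∃ C : ℝ, 0 ≤ C ∧ ∀ x, (Ioc (0:ℝ) 1).indicator (fun s => ENNReal.ofReal (h s)) x
      ≤ ENNReal.ofReal C * kk α x := by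
  obtain ⟨K, hK⟩ := hb
  have ga := Real.Gamma_pos_of_pos hα.1
  have hK0 : 0 ≤ K := (abs_nonneg _).trans (hK 1 ⟨one_pos, le_rfl⟩)
  refine ⟨K * Real.Gamma α, by positivity, fun x => ?_⟩
  by_cases hx : x ∈ Ioc (0:ℝ) 1
  · have hx0 := hx.1
    rw [indicator_of_mem hx, kk, if_pos hx.1, ← ENNReal.ofReal_mul (by positivity)]
    apply ENNReal.ofReal_le_ofReal
    have h1 := (le_abs_self _).trans (hK x hx)
    have e2 : x ^ (α - 1) * x ^ (1 - α) = 1 := by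
      rw [← Real.rpow_add hx.1]; simp
    calc h x = x ^ (α - 1) * (x ^ (1 - α) * h x) := by rw [← mul_assoc, e2, one_mul]
      _ ≤ x ^ (α - 1) * K := by gcongr
      _ = _ := by field_simp
  · rw [indicator_of_notMem hx]; exact zero_le

theorem stmt_8 (α c ybar0 : ℝ) (hα : α ∈ Set.Ioo (0:ℝ) 1) (hc : 0 ≤ c) (hybar0 : 0 ≤ ybar0)
    (ybar y : ℝ → ℝ)
    (hybar_cont : ContinuousOn ybar (Set.Ioc 0 1))
    (hybar_nonneg : ∀ ζ ∈ Set.Ioc (0:ℝ) 1, 0 ≤ ybar ζ)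
    (hybar_bdd : ∃ K, ∀ ζ ∈ Set.Ioc (0:ℝ) 1, |ζ ^ (1 - α) * ybar ζ| ≤ K)
    (hy_cont : ContinuousOn y (Set.Ioc 0 1))
    (hy_bdd : ∃ K, ∀ ζ ∈ Set.Ioc (0:ℝ) 1, |ζ ^ (1 - α) * y ζ| ≤ K)
    (hineq : ∀ ϑ ∈ Set.Ioc (0:ℝ) 1,
      y ϑ ≤ ybar0 / (Real.Gamma α * ϑ ^ (1 - α)) + ybar ϑ +
        (c / Real.Gamma α) * ∫ ζ in (0:ℝ)..ϑ, y ζ * (ϑ - ζ) ^ (α - 1)) :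
    ∀ ϑ ∈ Set.Ioc (0:ℝ) 1,
      y ϑ ≤ mittagLeffler α c * ybar0 / ϑ ^ (1 - α) + ybar ϑ +
        c * mittagLeffler α c * ∫ ζ in (0:ℝ)..ϑ, ybar ζ * (ϑ - ζ) ^ (α - 1) := by
  obtain ⟨Cb, hCb0, hCb⟩ := kk_bound hα ybar hybar_bdd
  obtain ⟨C, hC0, hC⟩ := kk_bound hα y hy_bdd
  have hα0 := hα.1
  have ga := Real.Gamma_pos_of_pos hα.1
  set F : ℝ → ENNReal := (Ioc (0:ℝ) 1).indicator (fun s => ENNReal.ofReal (ybar s)) with hFdef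
  set Y : ℝ → ENNReal := (Ioc (0:ℝ) 1).indicator (fun s => ENNReal.ofReal (y s)) with hYdef
  have hmb : Measurable ((Ioc (0:ℝ) 1).indicator ybar) := by
    rw [← Set.piecewise_eq_indicator]
    exact hybar_cont.measurable_piecewise continuousOn_const measurableSet_Ioc
  have hF : Measurable F := by
    have : F = fun x => ENNReal.ofReal ((Ioc (0:ℝ) 1).indicator ybar x) := by
      ext x
      by_cases hx : x ∈ Ioc (0:ℝ) 1
      · simp only [hFdef, indicator_of_mem hx]
      · simp only [hFdef, indicator_of_notMem hx, ENNReal.ofReal_zero]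
    rw [this]
    exact hmb.ennreal_ofReal
  have hstep : ∀ x, Y x ≤ ENNReal.ofReal ybar0 * kk α x + F x +
      ENNReal.ofReal c * lconvolution Y (kk α) volume x := by
    intro x
    by_cases hx : x ∈ Ioc (0:ℝ) 1
    · have hx0 := hx.1
      rw [conv_eq hα hx]
      rw [hYdef, hFdef, indicator_of_mem hx, indicator_of_mem hx, kk, if_pos hx.1,
        ← ENNReal.ofReal_mul hybar0]
      refine (ENNReal.ofReal_le_ofReal (hineq x hx)).trans ?_
      refine (ENNReal.ofReal_add_le).trans ?_
      refine add_le_add ((ENNReal.ofReal_add_le).trans (add_le_add (le_of_eq ?_) le_rfl)) ?_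
      · congr 1
        rw [show α - 1 = -(1 - α) by ring, Real.rpow_neg hx0.le]
        field_simp
      · rw [ENNReal.ofReal_mul (by positivity), ← mul_assoc, ← ENNReal.ofReal_mul hc,
          mul_one_div, intervalIntegral.integral_of_le hx0.le]
        gcongr
        exact ofReal_int_le _
    · rw [hYdef, indicator_of_notMem hx]; exact zero_le
  have hit := iter hα0 F Y hF (ENNReal.ofReal ybar0) (ENNReal.ofReal c) (ENNReal.ofReal C) hC hstep
  have hsum := ml_summable hα0 hc
  have hterm : ∀ k : ℕ, 0 ≤ c ^ k / Real.Gamma (α * (k + 1)) := fun k =>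
    div_nonneg (by positivity) (Real.Gamma_pos_of_pos (by positivity)).le
  have hE0 : 0 ≤ mittagLeffler α c := tsum_nonneg hterm
  have hpart : ∀ n : ℕ, ∑ k ∈ Finset.range n, c ^ k / Real.Gamma (α * (k + 1)) ≤ mittagLeffler α c :=
    fun n => hsum.sum_le_tsum _ (fun k _ => hterm k)
  have hkk : ∀ (k : ℕ) (u : ℝ), u ≤ 1 → ENNReal.ofReal (c ^ k) * kk (α * (k + 1)) u ≤
      ENNReal.ofReal (c ^ k / Real.Gamma (α * (k + 1))) * (ENNReal.ofReal (Real.Gamma α) * kk α u) := by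
    intro k u hu
    by_cases hu0 : 0 < u
    · have gk : 0 < Real.Gamma (α * (k + 1)) := Real.Gamma_pos_of_pos (by positivity)
      rw [kk, kk, if_pos hu0, if_pos hu0, ← ENNReal.ofReal_mul (by positivity),
        ← ENNReal.ofReal_mul (by positivity), ← ENNReal.ofReal_mul (by positivity)]
      apply ENNReal.ofReal_le_ofReal
      have : u ^ (α * (k + 1) - 1) ≤ u ^ (α - 1) := by
        apply Real.rpow_le_rpow_of_exponent_ge hu0 hu
        have : 0 ≤ α * k := by positivity
        linarith
      calc c ^ k * (u ^ (α * (k + 1) - 1) / Real.Gamma (α * (k + 1)))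
          = c ^ k / Real.Gamma (α * (k + 1)) * u ^ (α * (k + 1) - 1) := by ring
        _ ≤ c ^ k / Real.Gamma (α * (k + 1)) * u ^ (α - 1) := by gcongr
        _ = _ := by field_simp
    · simp [kk, hu0]
  intro t ht
  have ht0 := ht.1
  have hGk : ENNReal.ofReal (Real.Gamma α) * kk α t = ENNReal.ofReal (t ^ (α - 1)) := by
    rw [kk, if_pos ht0, ← ENNReal.ofReal_mul ga.le]
    congr 1; field_simp
  set I : ℝ := ∫ ζ in (0:ℝ)..t, ybar ζ * (t - ζ) ^ (α - 1) with hI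
  have hnn : ∀ s ∈ Ioc 0 t, 0 ≤ ybar s * (t - s) ^ (α - 1) := fun s hs =>
    mul_nonneg (hybar_nonneg s ⟨hs.1, hs.2.trans ht.2⟩) (Real.rpow_nonneg (by linarith [hs.2]) _)
  have hI0 : 0 ≤ I := by
    rw [hI, intervalIntegral.integral_of_le ht0.le]
    exact setIntegral_nonneg measurableSet_Ioc hnn
  have hconvI : ENNReal.ofReal (Real.Gamma α) * lconvolution F (kk α) volume t = ENNReal.ofReal I := by
    have hfin : lconvolution F (kk α) volume t ≠ ⊤ := by
      have : lconvolution F (kk α) volume t ≤ ENNReal.ofReal Cb * kk (α + α) t := by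
        rw [← kk_conv hα0 hα0, lconvolution_def, lconvolution_def,
          ← lintegral_const_mul' _ _ ENNReal.ofReal_ne_top]
        apply lintegral_mono
        intro s
        simp only [← mul_assoc]
        gcongr
        exact hCb s
      refine ne_top_of_le_ne_top (ENNReal.mul_ne_top ENNReal.ofReal_ne_top ?_) this
      rw [kk, if_pos ht0]; exact ENNReal.ofReal_ne_top
    rw [conv_eq hα ht] at hfin ⊢
    have hfin2 : ∫⁻ s in Ioc 0 t, ENNReal.ofReal (ybar s * (t - s) ^ (α - 1)) ≠ ⊤ := by
      intro h
      rw [h, ENNReal.mul_top (by simpa using ga)] at hfin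
      exact hfin rfl
    have hae : 0 ≤ᵐ[volume.restrict (Ioc 0 t)] fun s => ybar s * (t - s) ^ (α - 1) := by
      filter_upwards [ae_restrict_mem measurableSet_Ioc] with s hs using hnn s hs
    have hms : AEStronglyMeasurable (fun s => ybar s * (t - s) ^ (α - 1))
        (volume.restrict (Ioc 0 t)) := by
      apply AEStronglyMeasurable.mul
      · exact (hybar_cont.mono (Ioc_subset_Ioc_right ht.2)).aestronglyMeasurable measurableSet_Ioc
      · exact Measurable.aestronglyMeasurable (by fun_prop)
    have hint : Integrable (fun s => ybar s * (t - s) ^ (α - 1)) (volume.restrict (Ioc 0 t)) :=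
      (lintegral_ofReal_ne_top_iff_integrable hms hae).1 hfin2
    rw [hI, intervalIntegral.integral_of_le ht0.le, ofReal_integral_eq_lintegral_ofReal hint hae,
      ← mul_assoc, ← ENNReal.ofReal_mul ga.le, mul_one_div_cancel ga.ne', ENNReal.ofReal_one, one_mul]
  have hFc : ∀ k : ℕ, ENNReal.ofReal c ^ (k + 1) * lconvolution F (kk (α * (k + 1))) volume t ≤
      ENNReal.ofReal (c * (c ^ k / Real.Gamma (α * (k + 1)))) * ENNReal.ofReal I := by
    intro k
    rw [← hconvI, ENNReal.ofReal_mul hc, pow_succ', mul_assoc, mul_assoc]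
    refine mul_le_mul_right ?_ (ENNReal.ofReal c)
    rw [lconvolution_def, lconvolution_def, ← ENNReal.ofReal_pow hc,
      ← lintegral_const_mul' _ _ ENNReal.ofReal_ne_top,
      ← lintegral_const_mul' _ _ ENNReal.ofReal_ne_top,
      ← lintegral_const_mul' _ _ ENNReal.ofReal_ne_top]
    apply lintegral_mono
    intro s
    by_cases hs : 0 < s
    · have := hkk k (-s + t) (by linarith [ht.2])
      calc _ = F s * (ENNReal.ofReal (c ^ k) * kk (α * (k + 1)) (-s + t)) := by ring
        _ ≤ F s * (ENNReal.ofReal (c ^ k / Real.Gamma (α * (k + 1))) *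
              (ENNReal.ofReal (Real.Gamma α) * kk α (-s + t))) := mul_le_mul_right this _
        _ = _ := by ring
    · have : F s = 0 := indicator_of_notMem (fun h' => hs h'.1) _
      simp [this]
  have hmain : ∀ n : ℕ, ENNReal.ofReal (y t) ≤
      ENNReal.ofReal (mittagLeffler α c * ybar0 / t ^ (1 - α) + ybar t + c * mittagLeffler α c * I +
        C * (c ^ n / Real.Gamma (α * (n + 1)) * t ^ (α - 1))) := by
    intro n
    have h1 := hit n t
    rw [hYdef, indicator_of_mem ht] at h1
    refine h1.trans ?_
    have hbt := hybar_nonneg t ht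
    have htn := hterm n
    rw [ENNReal.ofReal_add (by positivity) (by positivity),
      ENNReal.ofReal_add (by positivity) (by positivity),
      ENNReal.ofReal_add (by positivity) (by positivity)]
    refine add_le_add (add_le_add (add_le_add ?_ ?_) ?_) ?_
    · calc _ ≤ ENNReal.ofReal ybar0 * ∑ k ∈ Finset.range n,
            ENNReal.ofReal (c ^ k / Real.Gamma (α * (k + 1))) * ENNReal.ofReal (t ^ (α - 1)) := by
            refine mul_le_mul_right (Finset.sum_le_sum fun k _ => ?_) _
            rw [← ENNReal.ofReal_pow hc, ← hGk]
            exact hkk k t ht.2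
        _ = ENNReal.ofReal (ybar0 * ((∑ k ∈ Finset.range n, c ^ k / Real.Gamma (α * (k + 1))) *
              t ^ (α - 1))) := by
            rw [← Finset.sum_mul, ← ENNReal.ofReal_sum_of_nonneg (fun k _ => hterm k),
              ← ENNReal.ofReal_mul (Finset.sum_nonneg fun k _ => hterm k), ← ENNReal.ofReal_mul hybar0]
        _ ≤ _ := by
            apply ENNReal.ofReal_le_ofReal
            rw [show mittagLeffler α c * ybar0 / t ^ (1 - α) =
              ybar0 * (mittagLeffler α c * t ^ (α - 1)) by
                rw [show α - 1 = -(1 - α) by ring, Real.rpow_neg ht0.le]; field_simp]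
            gcongr
            exact hpart n
    · rw [hFdef, indicator_of_mem ht]
    · calc _ ≤ ∑ k ∈ Finset.range n,
            ENNReal.ofReal (c * (c ^ k / Real.Gamma (α * (k + 1)))) * ENNReal.ofReal I :=
            Finset.sum_le_sum fun k _ => hFc k
        _ = ENNReal.ofReal ((c * ∑ k ∈ Finset.range n, c ^ k / Real.Gamma (α * (k + 1))) * I) := by
            rw [← Finset.sum_mul, ← ENNReal.ofReal_sum_of_nonneg
              (fun k _ => mul_nonneg hc (hterm k)), ← ENNReal.ofReal_mul
              (Finset.sum_nonneg fun k _ => mul_nonneg hc (hterm k)), Finset.mul_sum]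
        _ ≤ _ := by
            apply ENNReal.ofReal_le_ofReal
            gcongr
            exact hpart n
    · rw [mul_assoc, ENNReal.ofReal_mul hC0, ENNReal.ofReal_mul htn]
      refine mul_le_mul_right ?_ _
      rw [← ENNReal.ofReal_pow hc, ← hGk]
      exact hkk n t ht.2
  have hmain2 : ∀ n : ℕ, y t ≤ mittagLeffler α c * ybar0 / t ^ (1 - α) + ybar t +
      c * mittagLeffler α c * I + C * (c ^ n / Real.Gamma (α * (n + 1)) * t ^ (α - 1)) := by
    intro n
    have hbt := hybar_nonneg t ht
    have htn := hterm n
    exact (ENNReal.ofReal_le_ofReal_iff (by positivity)).1 (hmain n)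
  have hlim : Tendsto (fun n : ℕ => mittagLeffler α c * ybar0 / t ^ (1 - α) + ybar t +
      c * mittagLeffler α c * I + C * (c ^ n / Real.Gamma (α * (n + 1)) * t ^ (α - 1))) atTop
      (nhds (mittagLeffler α c * ybar0 / t ^ (1 - α) + ybar t +
      c * mittagLeffler α c * I + C * (0 * t ^ (α - 1)))) :=
    ((hsum.tendsto_atTop_zero.mul_const _).const_mul _).const_add _
  have := ge_of_tendsto' hlim hmain2
  simpa using this
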